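/- Let (Ω,𝒜) be a measurable space admitting a universally consistent learning rule 𝓛, and let Y ⊆ Ω be any subset, equipped with the trace sigma-algebra 𝒜|_Y = {A ∩ Y : A ∈ 𝒜}. Then the restriction of 𝓛 to Y, defined by (𝓛|_Y)ₙ = 𝓛ₙ restricted to Yⁿ×{0,1}ⁿ×Y, is a universally consistent learning rule for (Y, 𝒜|_Y). -/

import Mathlib

open MeasureTheory Filter Set Cardinal
open scoped ENNReal symmDiff

noncomputable section

universe u

/-- A *learning rule* on a measurable space `Ω`: a map assigning to every labelled sample
`σ ∈ Ωⁿ × {0,1}ⁿ` a classifier `Ω → {0,1}`, jointly measurable in the sample and the point. -/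
structure LearningRule (Ω : Type u) [MeasurableSpace Ω] where
  classify : (n : ℕ) → (Fin n → Ω × Bool) → Ω → Bool
  measurable : ∀ n : ℕ, Measurable fun q : (Fin n → Ω × Bool) × Ω => classify n q.1 q.2

/-- The expected misclassification error of the rule `L` at sample size `n`, for i.i.d.
labelled data with law `μt` on `Ω × {0,1}`. -/
def ruleError {Ω : Type u} [MeasurableSpace Ω] (L : LearningRule Ω)
    (μt : Measure (Ω × Bool)) (n : ℕ) : ℝ≥0∞ :=
  (Measure.pi fun _ : Fin n => μt).prod μt
    {q : (Fin n → Ω × Bool) × (Ω × Bool) | L.classify n q.1 q.2.1 ≠ q.2.2}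

/-- The Bayes (optimal) error of the learning problem given by a probability measure on
`Ω × {0,1}`: the infimum of the misclassification errors of all measurable classifiers. -/
def bayesError {Ω : Type u} [MeasurableSpace Ω] (μt : Measure (Ω × Bool)) : ℝ≥0∞ :=
  ⨅ (T : Ω → Bool) (_ : Measurable T), μt {p : Ω × Bool | T p.1 ≠ p.2}

/-- The probability measure on `Ω × {0,1}` determined by the learning problem `(μ, η)`:
its first marginal is `μ` and the conditional probability of the label `1` at `x` is `η x`. -/
def labelMeasure {Ω : Type u} [MeasurableSpace Ω] (μ : Measure Ω) (η : Ω → ℝ) :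
    Measure (Ω × Bool) :=
  μ.bind fun x =>
    ENNReal.ofReal (η x) • Measure.dirac (x, true) +
      ENNReal.ofReal (1 - η x) • Measure.dirac (x, false)

/-- The rule `L` is consistent for the learning problem `(μ, η)`. -/
def ConsistentFor {Ω : Type u} [MeasurableSpace Ω] (L : LearningRule Ω)
    (μ : Measure Ω) (η : Ω → ℝ) : Prop :=
  Tendsto (ruleError L (labelMeasure μ η)) atTop (nhds (bayesError (labelMeasure μ η)))


/-- A rule `L` is universally consistent: consistent under every probability measure on
`Ω × {0,1}`. -/
def UniversallyConsistentRule {Ω : Type u} [MeasurableSpace Ω] (L : LearningRule Ω) : Prop :=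
  ∀ μt : Measure (Ω × Bool), IsProbabilityMeasure μt →
    Tendsto (ruleError L μt) atTop (nhds (bayesError μt))

/-- The restriction of a learning rule on `Ω` to a subset `Y ⊆ Ω`, carrying the trace
sigma-algebra `{A ∩ Y : A ∈ 𝒜}` (the subtype sigma-algebra). -/
def LearningRule.restrict {Ω : Type u} [MeasurableSpace Ω] (L : LearningRule Ω)
    (Y : Set Ω) : LearningRule Y where
  classify n σ x := L.classify n (fun i => (((σ i).1 : Ω), (σ i).2)) (x : Ω)
  measurable n := by
    have h : Measurable fun q : (Fin n → Y × Bool) × Y =>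
        (((fun i => (((q.1 i).1 : Ω), (q.1 i).2)), (q.2 : Ω)) :
          (Fin n → Ω × Bool) × Ω) := by
      refine Measurable.prodMk ?_ (measurable_subtype_coe.comp measurable_snd)
      refine measurable_pi_lambda _ fun i => ?_
      exact (measurable_subtype_coe.comp
          (((measurable_pi_apply i).comp measurable_fst).fst)).prodMk
        (((measurable_pi_apply i).comp measurable_fst).snd)
    exact (L.measurable n).comp h

namespace LearningRule

variable {Ω : Type u} [MeasurableSpace Ω]

/-- The error of a restricted rule is the error of the rule under the pushed forward law. -/
theorem ruleError_map_subtype_val (L : LearningRule Ω) (Y : Set Ω) (μt : Measure (Y × Bool))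
    [IsProbabilityMeasure μt] (n : ℕ) :
    ruleError L (μt.map (Prod.map Subtype.val id)) n = ruleError (L.restrict Y) μt n := by
  have hι : Measurable (Prod.map Subtype.val id : Y × Bool → Ω × Bool) :=
    measurable_subtype_coe.prodMap measurable_id
  have : IsProbabilityMeasure (μt.map (Prod.map Subtype.val id : Y × Bool → Ω × Bool)) :=
    Measure.isProbabilityMeasure_map hι.aemeasurable
  have hpi : Measurable fun (σ : Fin n → Y × Bool) i => Prod.map Subtype.val id (σ i) :=
    measurable_pi_lambda _ fun i => hι.comp (measurable_pi_apply i)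
  have hclassify : Measurable fun q : (Fin n → Ω × Bool) × (Ω × Bool) =>
      L.classify n q.1 q.2.1 :=
    (L.measurable n).comp (measurable_fst.prodMk measurable_snd.fst)
  have hset : MeasurableSet
      {q : (Fin n → Ω × Bool) × (Ω × Bool) | L.classify n q.1 q.2.1 ≠ q.2.2} :=
    (measurableSet_eq_fun hclassify measurable_snd.snd).compl
  unfold ruleError
  rw [← Measure.pi_map_pi fun _ => hι.aemeasurable, Measure.map_prod_map _ _ hpi hι,
    Measure.map_apply (hpi.prodMap hι) hset]
  rfl

/-- Pushing a law forward along the inclusion of a subset preserves the Bayes error. -/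
theorem bayesError_map_subtype_val (Y : Set Ω) (μt : Measure (Y × Bool)) :
    bayesError (μt.map (Prod.map Subtype.val id : Y × Bool → Ω × Bool)) = bayesError μt := by
  have hι : Measurable (Prod.map Subtype.val id : Y × Bool → Ω × Bool) :=
    measurable_subtype_coe.prodMap measurable_id
  have herror (T : Ω → Bool) (hT : Measurable T) :
      μt.map (Prod.map Subtype.val id) {p : Ω × Bool | T p.1 ≠ p.2} =
        μt {p : Y × Bool | T p.1 ≠ p.2} :=
    Measure.map_apply hι
      (measurableSet_eq_fun (hT.comp measurable_fst) measurable_snd).compl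
  refine le_antisymm (le_iInf₂ fun T hT => ?_) (le_iInf₂ fun T hT => ?_)
  · obtain ⟨T', hT', rfl⟩ : ∃ T' : Ω → Bool, Measurable T' ∧ T = T' ∘ Subtype.val :=
      hT.exists_eq_measurable_comp
    exact (iInf₂_le T' hT').trans_eq (herror T' hT')
  · rw [herror T hT]
    exact iInf₂_le (fun x : Y => T x) (hT.comp measurable_subtype_coe)

end LearningRule

/-- **Lemma.** Let `(Ω, 𝒜)` be a measurable space admitting a universally consistent
learning rule `L`, and let `Y ⊆ Ω` be any subset, equipped with the trace sigma-algebra.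
Then the restriction of `L` to `Y` is a universally consistent learning rule for `Y`. -/
theorem LearningRule.restrict_universallyConsistent
    {Ω : Type u} [MeasurableSpace Ω] (L : LearningRule Ω)
    (hL : UniversallyConsistentRule L) (Y : Set Ω) :
    UniversallyConsistentRule (L.restrict Y) := by
  intro μt _
  have hι : Measurable (Prod.map Subtype.val id : Y × Bool → Ω × Bool) :=
    measurable_subtype_coe.prodMap measurable_id
  have h := hL _ (Measure.isProbabilityMeasure_map (μ := μt) hι.aemeasurable)
  rwa [LearningRule.bayesError_map_subtype_val,
    funext (LearningRule.ruleError_map_subtype_val L Y μt)] at h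

end
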